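/- arXiv:0902.3738 — 2 statements merged into one kernel-verified Lean document; each statement's English description precedes it below -/
import Mathlib

section
/- Define α : (ℍ⊕ℍ) × (ℍ⊕ℍ) → ℍ by α(u,v) = (x_u x̄_v − x_v x̄_u) − (y_u ȳ_v − y_v ȳ_u), where u = (x_u,y_u), v = (x_v,y_v). Then α is ℝ-bilinear, alternating, takes values in the purely imaginary quaternions, and for all unit quaternions q₊, q₋, q₀ it satisfies the equivariance law α(κu, κv) = q₊ α(u,v) q̄₊, where κ = κ(q₊,q₋,q₀). -/
noncomputable section

abbrev H := Quaternion ℝ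

def qi : H := ⟨0,1,0,0⟩
def qj : H := ⟨0,0,1,0⟩
def qk : H := ⟨0,0,0,1⟩

def e : Fin 4 → H := ![1, qi, qj, qk]

def f : Fin 8 → H × H := ![(1,0),(qi,0),(qj,0),(qk,0),(0,1),(0,qi),(0,qj),(0,qk)]

def kappa (qp qm q0 : H) (u : H × H) : H × H :=
  (qp * u.1 * star qm, qp * u.2 * star q0)

def IsUnitQ (q : H) : Prop := ‖q‖ = 1

def innerHH (u v : H × H) : ℝ := (u.1 * star v.1).re + (u.2 * star v.2).re

def Om (u : Fin 4 → H × H) : ℝ :=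
  -(1/24) * ∑ σ : Equiv.Perm (Fin 4), ((Equiv.Perm.sign σ : ℤ) : ℝ) *
    ((u (σ 0)).1 * star ((u (σ 1)).1) * (u (σ 2)).1 * star ((u (σ 3)).1)
      - 6 * ((u (σ 0)).1 * star ((u (σ 1)).1) * (u (σ 2)).2 * star ((u (σ 3)).2))
      + (u (σ 0)).2 * star ((u (σ 1)).2) * (u (σ 2)).2 * star ((u (σ 3)).2)).re

def alphaF (u v : H × H) : H :=
  (u.1 * star v.1 - v.1 * star u.1) - (u.2 * star v.2 - v.2 * star u.2)

def betaF (u v : H × H) : H := star u.1 * v.2 - star v.1 * u.2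

def omegaF : Fin 7 → (H × H) → (H × H) → ℝ :=
  ![fun u v => (alphaF u v).imI,
    fun u v => (alphaF u v).imJ,
    fun u v => (alphaF u v).imK,
    fun u v => (betaF u v).re,
    fun u v => (betaF u v).imI,
    fun u v => (betaF u v).imJ,
    fun u v => (betaF u v).imK]

def formInner (a b : (H × H) → (H × H) → ℝ) : ℝ :=
  ∑ p : Fin 8, ∑ q ∈ Finset.Ioi p, a (f p) (f q) * b (f p) (f q)

def IsAlt2 (τ : (H × H) → (H × H) → ℝ) : Prop :=
  (∀ u, IsLinearMap ℝ (τ u)) ∧ (∀ v, IsLinearMap ℝ fun u => τ u v) ∧ ∀ u, τ u u = 0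

def wedge422 (A4 : (Fin 4 → H × H) → ℝ) (a b : (H × H) → (H × H) → ℝ) : ℝ :=
  ∑ σ ∈ Finset.univ.filter (fun σ : Equiv.Perm (Fin 8) =>
      σ 0 < σ 1 ∧ σ 1 < σ 2 ∧ σ 2 < σ 3 ∧ σ 4 < σ 5 ∧ σ 6 < σ 7),
    ((Equiv.Perm.sign σ : ℤ) : ℝ) * A4 ![f (σ 0), f (σ 1), f (σ 2), f (σ 3)]
      * a (f (σ 4)) (f (σ 5)) * b (f (σ 6)) (f (σ 7))

def coordM (x : Fin 4 → H) : Matrix (Fin 4) (Fin 4) ℝ :=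
  Matrix.of fun m => ![(x m).re, (x m).imI, (x m).imJ, (x m).imK]

theorem star_mul_self_of_isUnitQ {q : H} (hq : IsUnitQ q) : star q * q = 1 := by
  rw [Quaternion.star_mul_self, Quaternion.normSq_eq_norm_mul_self, hq]
  simp

theorem mul_star_mul_of_isUnitQ {q : H} (hq : IsUnitQ q) (p x y : H) :
    p * x * star q * star (p * y * star q) = p * (x * star y) * star p := by
  calc p * x * star q * star (p * y * star q)
      = p * x * (star q * q) * star y * star p := by simp only [star_mul, star_star, mul_assoc]
    _ = p * (x * star y) * star p := by
      rw [star_mul_self_of_isUnitQ hq, mul_one, mul_assoc p x]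

/-- α(u,v) = (x_u x̄_v − x_v x̄_u) − (y_u ȳ_v − y_v ȳ_u) is ℝ-bilinear,
alternating, purely imaginary, and κ-equivariant: α(κu,κv) = q₊ α(u,v) q̄₊. -/
theorem stmt4 :
    (∀ u, IsLinearMap ℝ (alphaF u)) ∧
    (∀ v, IsLinearMap ℝ fun u => alphaF u v) ∧
    (∀ u, alphaF u u = 0) ∧
    (∀ u v, (alphaF u v).re = 0) ∧
    (∀ qp qm q0 : H, IsUnitQ qp → IsUnitQ qm → IsUnitQ q0 →
      ∀ u v, alphaF (kappa qp qm q0 u) (kappa qp qm q0 v) = qp * alphaF u v * star qp) := by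
  refine ⟨fun u => ⟨fun v w => ?_, fun c v => ?_⟩, fun v => ⟨fun u w => ?_, fun c u => ?_⟩,
    fun u => ?_, fun u v => ?_, fun qp qm q0 _ hm h0 u v => ?_⟩
  · simp only [alphaF, Prod.fst_add, Prod.snd_add, star_add, mul_add, add_mul]
    abel
  · simp only [alphaF, Prod.smul_fst, Prod.smul_snd, Quaternion.star_smul, mul_smul_comm,
      smul_mul_assoc, smul_sub]
  · simp only [alphaF, Prod.fst_add, Prod.snd_add, star_add, mul_add, add_mul]
    abel
  · simp only [alphaF, Prod.smul_fst, Prod.smul_snd, Quaternion.star_smul, mul_smul_comm,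
      smul_mul_assoc, smul_sub]
  · simp [alphaF]
  · simp only [alphaF, Quaternion.re_sub, Quaternion.re_mul, Quaternion.re_star,
      Quaternion.imI_star, Quaternion.imJ_star, Quaternion.imK_star]
    ring
  · simp only [alphaF, kappa, mul_star_mul_of_isUnitQ hm, mul_star_mul_of_isUnitQ h0,
      mul_sub, sub_mul]
end
end

section
/- Every alternating 2-form ω on ℍ ⊕ ℍ that is orthogonal to all seven forms ω₁, …, ω₇ is an eigenvector with eigenvalue −1 of the operator ω ↦ ∗(Ω ∧ ω): if ⟨ω, ω_i⟩ = 0 for all i = 1,…,7, then for every alternating 2-form τ on ℍ ⊕ ℍ, (Ω ∧ ω ∧ τ)(f₀, f₁, …, f₇) = −⟨ω, τ⟩. -/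
noncomputable section

def quatCast (q : Quaternion ℤ) : H := ⟨q.re, q.imI, q.imJ, q.imK⟩

@[simp] lemma quatCast_re (q : Quaternion ℤ) : (quatCast q).re = q.re := rfl

@[simp] lemma quatCast_imI (q : Quaternion ℤ) : (quatCast q).imI = q.imI := rfl

@[simp] lemma quatCast_imJ (q : Quaternion ℤ) : (quatCast q).imJ = q.imJ := rfl

@[simp] lemma quatCast_imK (q : Quaternion ℤ) : (quatCast q).imK = q.imK := rfl

lemma quatCast_mul (a b : Quaternion ℤ) : quatCast (a * b) = quatCast a * quatCast b := by
  apply Quaternion.ext <;> simp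

lemma quatCast_star (a : Quaternion ℤ) : quatCast (star a) = star (quatCast a) := by
  apply Quaternion.ext <;> simp

lemma quatCast_sub (a b : Quaternion ℤ) : quatCast (a - b) = quatCast a - quatCast b := by
  apply Quaternion.ext <;> simp

def fInt : Fin 8 → Quaternion ℤ × Quaternion ℤ :=
  ![(⟨1, 0, 0, 0⟩, ⟨0, 0, 0, 0⟩), (⟨0, 1, 0, 0⟩, ⟨0, 0, 0, 0⟩),
    (⟨0, 0, 1, 0⟩, ⟨0, 0, 0, 0⟩), (⟨0, 0, 0, 1⟩, ⟨0, 0, 0, 0⟩),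
    (⟨0, 0, 0, 0⟩, ⟨1, 0, 0, 0⟩), (⟨0, 0, 0, 0⟩, ⟨0, 1, 0, 0⟩),
    (⟨0, 0, 0, 0⟩, ⟨0, 0, 1, 0⟩), (⟨0, 0, 0, 0⟩, ⟨0, 0, 0, 1⟩)]

lemma f_eq_quatCast (p : Fin 8) : f p = (quatCast (fInt p).1, quatCast (fInt p).2) := by
  have h0 : (0 : H) = ⟨0, 0, 0, 0⟩ := rfl
  have h1 : (1 : H) = ⟨1, 0, 0, 0⟩ := rfl
  fin_cases p <;> simp [f, fInt, qi, qj, qk, quatCast, h0, h1]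

/-- `-24 • Om` on basis vectors. -/
def omInt (a : Fin 4 → Fin 8) : ℤ :=
  ∑ σ : Equiv.Perm (Fin 4), (Equiv.Perm.sign σ : ℤ) *
    (((fInt (a (σ 0))).1 * star (fInt (a (σ 1))).1 *
        ((fInt (a (σ 2))).1 * star (fInt (a (σ 3))).1)).re
      - 6 * ((fInt (a (σ 0))).1 * star (fInt (a (σ 1))).1 *
        ((fInt (a (σ 2))).2 * star (fInt (a (σ 3))).2)).re
      + ((fInt (a (σ 0))).2 * star (fInt (a (σ 1))).2 *
        ((fInt (a (σ 2))).2 * star (fInt (a (σ 3))).2)).re)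

lemma re_six_mul (q : H) : (6 * q).re = 6 * q.re := by
  have : (6 : H) = ((6 : ℝ) : H) := by norm_cast
  rw [this, Quaternion.coe_mul_eq_smul, Quaternion.re_smul, smul_eq_mul]

/-- `Om` on increasing quadruples of basis vectors. -/
def omCoeff (t : Fin 8 × Fin 8 × Fin 8 × Fin 8) : ℤ :=
  if t ∈ [(0, 1, 2, 3), (0, 2, 5, 7), (1, 3, 4, 6), (4, 5, 6, 7)] then 1
  else if t ∈ [(0, 1, 4, 5), (0, 1, 6, 7), (0, 2, 4, 6), (0, 3, 4, 7), (0, 3, 5, 6),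
    (1, 2, 4, 7), (1, 2, 5, 6), (1, 3, 5, 7), (2, 3, 4, 5), (2, 3, 6, 7)] then -1
  else 0

lemma omInt_eq : ∀ a b c d : Fin 8, a < b → b < c → c < d →
    omInt ![a, b, c, d] = -24 * omCoeff (a, b, c, d) := by
  decide +kernel

lemma Om_basis (a : Fin 4 → Fin 8) : Om (fun m => f (a m)) = -(1 / 24) * omInt a := by
  simp only [Om, omInt, f_eq_quatCast, mul_assoc, Quaternion.re_add, Quaternion.re_sub,
    re_six_mul, ← quatCast_mul, ← quatCast_star, quatCast_re]
  push_cast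
  rfl

def omegaInt (k : Fin 7) (p q : Fin 8) : ℤ :=
  let u := fInt p
  let v := fInt q
  let α := (u.1 * star v.1 - v.1 * star u.1) - (u.2 * star v.2 - v.2 * star u.2)
  let β := star u.1 * v.2 - star v.1 * u.2
  ![α.imI, α.imJ, α.imK, β.re, β.imI, β.imJ, β.imK] k

lemma omegaF_basis (k : Fin 7) (p q : Fin 8) : omegaF k (f p) (f q) = omegaInt k p q := by
  have hα : alphaF (f p) (f q) = quatCast
      (((fInt p).1 * star (fInt q).1 - (fInt q).1 * star (fInt p).1)
        - ((fInt p).2 * star (fInt q).2 - (fInt q).2 * star (fInt p).2)) := by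
    simp only [alphaF, f_eq_quatCast, quatCast_sub, quatCast_mul, quatCast_star]
  have hβ : betaF (f p) (f q) = quatCast
      (star (fInt p).1 * (fInt q).2 - star (fInt q).1 * (fInt p).2) := by
    simp only [betaF, f_eq_quatCast, quatCast_sub, quatCast_mul, quatCast_star]
  fin_cases k
  · exact congrArg QuaternionAlgebra.imI hα
  · exact congrArg QuaternionAlgebra.imJ hα
  · exact congrArg QuaternionAlgebra.imK hα
  · exact congrArg QuaternionAlgebra.re hβ
  · exact congrArg QuaternionAlgebra.imI hβ
  · exact congrArg QuaternionAlgebra.imJ hβ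
  · exact congrArg QuaternionAlgebra.imK hβ

/-- The `(4, 2, 2)`-shuffles of `Fin 8`. -/
def shuffles : Finset (Equiv.Perm (Fin 8)) :=
  Finset.univ.filter fun σ =>
    σ 0 < σ 1 ∧ σ 1 < σ 2 ∧ σ 2 < σ 3 ∧ σ 4 < σ 5 ∧ σ 6 < σ 7

lemma shuffle_head_eq {σ : Equiv.Perm (Fin 8)} (hσ : σ ∈ shuffles) :
    ∃ h : ({σ 4, σ 5, σ 6, σ 7} : Finset (Fin 8))ᶜ.card = 4,
      ![σ 0, σ 1, σ 2, σ 3] = Finset.orderEmbOfFin _ h := by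
  simp only [shuffles, Finset.mem_filter, Finset.mem_univ, true_and] at hσ
  obtain ⟨h01, h12, h23, -, -⟩ := hσ
  have hc : ({σ 4, σ 5, σ 6, σ 7} : Finset (Fin 8))ᶜ.card = 4 := by
    have : ({σ 4, σ 5, σ 6, σ 7} : Finset (Fin 8)) = ({4, 5, 6, 7} : Finset (Fin 8)).image σ := by
      simp [Finset.image_insert]
    rw [this, Finset.card_compl, Finset.card_image_of_injective _ σ.injective]
    rfl
  refine ⟨hc, Finset.orderEmbOfFin_unique hc (fun i => ?_) ?_⟩
  · fin_cases i <;> simp [σ.injective.eq_iff]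
  · rw [Fin.strictMono_iff_lt_succ]
    intro i
    fin_cases i <;> simpa

lemma shuffle_ext {σ π : Equiv.Perm (Fin 8)} (hσ : σ ∈ shuffles) (hπ : π ∈ shuffles)
    (h4 : σ 4 = π 4) (h5 : σ 5 = π 5) (h6 : σ 6 = π 6) (h7 : σ 7 = π 7) : σ = π := by
  obtain ⟨h, e⟩ := shuffle_head_eq hσ
  obtain ⟨h', e'⟩ := shuffle_head_eq hπ
  have key : ![σ 0, σ 1, σ 2, σ 3] = ![π 0, π 1, π 2, π 3] := by
    rw [e, e']
    simp only [h4, h5, h6, h7]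
  ext i
  have h0 := congrFun key 0
  have h1 := congrFun key 1
  have h2 := congrFun key 2
  have h3 := congrFun key 3
  simp only [Matrix.cons_val] at h0 h1 h2 h3
  fin_cases i <;> simp [*]

/-- The values of the shuffle with prescribed last four values. -/
def shuffleFun (p q r s : Fin 8) : Fin 8 → Fin 8 :=
  let l := (List.finRange 8).filter fun i => i ≠ p ∧ i ≠ q ∧ i ≠ r ∧ i ≠ s
  ![l.getD 0 0, l.getD 1 0, l.getD 2 0, l.getD 3 0, p, q, r, s]

def Disj (p q r s : Fin 8) : Prop := p ≠ r ∧ p ≠ s ∧ q ≠ r ∧ q ≠ s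

instance (p q r s : Fin 8) : Decidable (Disj p q r s) := by unfold Disj; infer_instance

lemma shuffleFun_spec : ∀ p q r s : Fin 8, p < q → r < s → Disj p q r s →
    (∀ i j, shuffleFun p q r s i = shuffleFun p q r s j → i = j) ∧
    shuffleFun p q r s 0 < shuffleFun p q r s 1 ∧ shuffleFun p q r s 1 < shuffleFun p q r s 2 ∧
    shuffleFun p q r s 2 < shuffleFun p q r s 3 := by
  decide +kernel

lemma exists_shuffle {p q r s : Fin 8} (hpq : p < q) (hrs : r < s) (h : Disj p q r s) :
    ∃ π ∈ shuffles, ⇑π = shuffleFun p q r s := by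
  obtain ⟨hi, h0, h1, h2⟩ := shuffleFun_spec p q r s hpq hrs h
  refine ⟨Equiv.ofBijective _ (Finite.injective_iff_bijective.1 fun i j => hi i j), ?_, rfl⟩
  simp only [shuffles, Finset.mem_filter, Finset.mem_univ, true_and, Equiv.ofBijective_apply]
  exact ⟨h0, h1, h2, hpq, hrs⟩

/-- The coefficient which a shuffle contributes to `wedge422 Om`. -/
def shuffleCoeff (a : Fin 8 → Fin 8) : ℤ :=
  (∏ j, ∏ i ∈ Finset.Iio j, if a i < a j then 1 else -1) * omCoeff (a 0, a 1, a 2, a 3)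

lemma shuffleCoeff_eq {σ : Equiv.Perm (Fin 8)} (hσ : σ ∈ shuffles) :
    ((Equiv.Perm.sign σ : ℤ) : ℝ) * Om ![f (σ 0), f (σ 1), f (σ 2), f (σ 3)]
      = shuffleCoeff σ := by
  have h : ![f (σ 0), f (σ 1), f (σ 2), f (σ 3)]
      = fun m => f (![σ 0, σ 1, σ 2, σ 3] m) := by
    ext1 m
    fin_cases m <;> rfl
  simp only [shuffles, Finset.mem_filter, Finset.mem_univ, true_and] at hσ
  rw [h, Om_basis, omInt_eq _ _ _ _ hσ.1 hσ.2.1 hσ.2.2.1, shuffleCoeff,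
    Equiv.Perm.sign_eq_prod_prod_Iio]
  push_cast [apply_ite]
  ring

lemma shuffleCoeff_table : ∀ p q r s : Fin 8, p < q → r < s →
    4 * (if Disj p q r s then shuffleCoeff (shuffleFun p q r s) else 0) =
      -4 * (if p = r ∧ q = s then 1 else 0) +
        ∑ k : Fin 7, (if k < 3 then 1 else 4) * omegaInt k p q * omegaInt k r s := by
  decide +kernel

lemma sum_shuffles_fiber (p q r s : Fin 8) (hpq : p < q) (hrs : r < s) :
    ∑ σ ∈ shuffles with σ 4 = p ∧ σ 5 = q ∧ σ 6 = r ∧ σ 7 = s, shuffleCoeff σ =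
      if Disj p q r s then shuffleCoeff (shuffleFun p q r s) else 0 := by
  split_ifs with h
  · obtain ⟨π, hπ, e⟩ := exists_shuffle hpq hrs h
    have hv : π 4 = p ∧ π 5 = q ∧ π 6 = r ∧ π 7 = s := by rw [e]; exact ⟨rfl, rfl, rfl, rfl⟩
    rw [Finset.sum_eq_single_of_mem π (Finset.mem_filter.2 ⟨hπ, hv⟩), e]
    intro σ hσ hne
    obtain ⟨hσ, h4, h5, h6, h7⟩ := Finset.mem_filter.1 hσ
    exact absurd (shuffle_ext hσ hπ (h4.trans hv.1.symm) (h5.trans hv.2.1.symm)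
      (h6.trans hv.2.2.1.symm) (h7.trans hv.2.2.2.symm)) hne
  · refine Finset.sum_eq_zero fun σ hσ => absurd ?_ h
    obtain ⟨-, rfl, rfl, rfl, rfl⟩ := Finset.mem_filter.1 hσ
    simp [Disj, σ.injective.eq_iff]

/-- The index pairs of the coordinates of a 2-form on `Fin 8`. -/
def pairs : Finset (Fin 8 × Fin 8) := Finset.univ.filter fun x => x.1 < x.2

lemma formInner_eq_sum_pairs (a b : (H × H) → (H × H) → ℝ) :
    formInner a b = ∑ x ∈ pairs, a (f x.1) (f x.2) * b (f x.1) (f x.2) := by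
  simp only [formInner, pairs, Finset.sum_filter, Fintype.sum_prod_type]
  refine Finset.sum_congr rfl fun p _ => ?_
  rw [← Finset.sum_filter]
  exact Finset.sum_congr (by ext; simp) fun _ _ => rfl

lemma wedge422_Om_eq_sum_pairs (a b : (H × H) → (H × H) → ℝ) :
    wedge422 Om a b = ∑ x ∈ pairs, ∑ y ∈ pairs,
      ((if Disj x.1 x.2 y.1 y.2 then shuffleCoeff (shuffleFun x.1 x.2 y.1 y.2) else 0 : ℤ) : ℝ)
        * a (f x.1) (f x.2) * b (f y.1) (f y.2) := by
  have h : ∀ σ ∈ shuffles, ((σ 4, σ 5), (σ 6, σ 7)) ∈ pairs ×ˢ pairs := fun σ hσ => by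
    simp only [shuffles, Finset.mem_filter, Finset.mem_univ, true_and] at hσ
    simp [pairs, hσ.2.2.2]
  rw [← Finset.sum_product', wedge422]
  change ∑ σ ∈ shuffles, _ = _
  rw [← Finset.sum_fiberwise_of_maps_to h]
  refine Finset.sum_congr rfl fun ⟨⟨p, q⟩, r, s⟩ hx => ?_
  simp only [pairs, Finset.mem_product, Finset.mem_filter, Finset.mem_univ, true_and] at hx
  rw [← sum_shuffles_fiber p q r s hx.1 hx.2]
  push_cast
  simp only [Finset.sum_mul, Prod.mk.injEq, and_assoc]
  refine Finset.sum_congr rfl fun σ hσ => ?_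
  obtain ⟨hmem, rfl, rfl, rfl, rfl⟩ := Finset.mem_filter.1 hσ
  rw [shuffleCoeff_eq hmem]

lemma wedge422_Om_eq (a b : (H × H) → (H × H) → ℝ) :
    4 * wedge422 Om a b = -4 * formInner a b +
      ∑ k : Fin 7, (if k < 3 then 1 else 4) * formInner a (omegaF k) * formInner b (omegaF k) := by
  have key : ∀ x ∈ pairs, ∀ y ∈ pairs,
      4 * (((if Disj x.1 x.2 y.1 y.2 then shuffleCoeff (shuffleFun x.1 x.2 y.1 y.2) else 0 : ℤ)
        : ℝ) * a (f x.1) (f x.2) * b (f y.1) (f y.2)) =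
      -4 * (if x = y then a (f x.1) (f x.2) * b (f y.1) (f y.2) else 0) +
        ∑ k : Fin 7, (if k < 3 then 1 else 4) * (a (f x.1) (f x.2) * omegaF k (f x.1) (f x.2)) *
          (b (f y.1) (f y.2) * omegaF k (f y.1) (f y.2)) := by
    intro x hx y hy
    have h := congrArg (Int.cast : ℤ → ℝ) (shuffleCoeff_table x.1 x.2 y.1 y.2
      (Finset.mem_filter.1 hx).2 (Finset.mem_filter.1 hy).2)
    rw [Int.cast_mul] at h
    rw [← mul_assoc, ← mul_assoc, show (4 : ℝ) = ((4 : ℤ) : ℝ) by norm_num, h]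
    simp only [omegaF_basis, ← Prod.ext_iff]
    push_cast [apply_ite]
    rw [add_mul, add_mul, Finset.sum_mul, Finset.sum_mul]
    congr 1
    · split_ifs <;> ring
    · exact Finset.sum_congr rfl fun k _ => by ring
  rw [wedge422_Om_eq_sum_pairs]
  simp only [Finset.mul_sum]
  rw [Finset.sum_congr rfl fun x hx => Finset.sum_congr rfl (key x hx)]
  simp only [Finset.sum_add_distrib, formInner_eq_sum_pairs]
  congr 1
  · rw [Finset.mul_sum]
    refine Finset.sum_congr rfl fun x hx => ?_
    rw [← Finset.mul_sum, Finset.sum_ite_eq, if_pos hx]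
  · rw [Finset.sum_congr rfl fun x _ => Finset.sum_comm, Finset.sum_comm]
    refine Finset.sum_congr rfl fun k _ => ?_
    rw [mul_assoc, Finset.sum_mul_sum, Finset.mul_sum]
    refine Finset.sum_congr rfl fun x _ => ?_
    rw [Finset.mul_sum]
    exact Finset.sum_congr rfl fun y _ => by ring

/-- every alternating 2-form ω orthogonal to ω₁,…,ω₇ is an eigenvector
with eigenvalue −1 of ω ↦ ∗(Ω ∧ ω): (Ω ∧ ω ∧ τ)(f₀,…,f₇) = −⟨ω,τ⟩ for all alternating τ. -/
theorem stmt8 : ∀ ω : (H × H) → (H × H) → ℝ, IsAlt2 ω →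
    (∀ i : Fin 7, formInner ω (omegaF i) = 0) →
    ∀ τ : (H × H) → (H × H) → ℝ, IsAlt2 τ →
      wedge422 Om ω τ = -formInner ω τ := by
  intro ω _ h τ _
  have key := wedge422_Om_eq ω τ
  simp only [h, mul_zero, zero_mul, Finset.sum_const_zero, add_zero] at key
  linarith
end
end
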